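/- For p ∈ ℝ, the function h_p(x) = (1-x)^p · K(x) is strictly log-concave on (0,1) if and only if p ≥ 7/32, and strictly log-convex on (0,1) if and only if p ≤ 0. -/

import Mathlib

open Real Set Filter

noncomputable def K (x : ℝ) : ℝ :=
  ∫ t in (0 : ℝ)..(π / 2), (1 - x * Real.sin t ^ 2) ^ (-(1/2) : ℝ)

noncomputable def E (x : ℝ) : ℝ :=
  ∫ t in (0 : ℝ)..(π / 2), (1 - x * Real.sin t ^ 2) ^ ((1/2) : ℝ)

lemma base_ge {x c : ℝ} (hx : x ≤ c) (hc : 0 ≤ c) (t : ℝ) : 1 - c ≤ 1 - x * Real.sin t ^ 2 := by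
  have h1 := Real.sin_sq_le_one t
  have h0 := sq_nonneg (Real.sin t)
  nlinarith

lemma base_pos {x : ℝ} (hx1 : x < 1) (t : ℝ) : 0 < 1 - x * Real.sin t ^ 2 := by
  have h := base_ge (x := x) (c := max x 0) (le_max_left _ _) (le_max_right _ _) t
  have : max x 0 < 1 := max_lt hx1 one_pos
  linarith

lemma cont_pow {x : ℝ} (hx1 : x < 1) (s : ℝ) :
    Continuous (fun t : ℝ => (1 - x * Real.sin t ^ 2) ^ s) := by
  refine Continuous.rpow_const (by fun_prop) (fun t => Or.inl (base_pos hx1 t).ne')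

lemma hasDeriv_J (s : ℝ) (hs : s ≤ 1) {x : ℝ} (hx0 : -1 < x) (hx1 : x < 1) :
    HasDerivAt (fun x : ℝ => ∫ t in (0 : ℝ)..(π / 2), (1 - x * Real.sin t ^ 2) ^ s)
      (∫ t in (0 : ℝ)..(π / 2), s * (1 - x * Real.sin t ^ 2) ^ (s - 1) * (-Real.sin t ^ 2)) x := by
  have hc : 0 ≤ (1 + x) / 2 := by linarith
  have hc1 : (1 + x) / 2 < 1 := by linarith
  refine (intervalIntegral.hasDerivAt_integral_of_dominated_loc_of_deriv_le
    (F := fun x t => (1 - x * Real.sin t ^ 2) ^ s)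
    (F' := fun x t => s * (1 - x * Real.sin t ^ 2) ^ (s - 1) * (-Real.sin t ^ 2))
    (s := Iio ((1 + x) / 2)) (bound := fun _ => |s| * (1 - (1 + x) / 2) ^ (s - 1))
    (Iio_mem_nhds (by linarith)) ?_ ?_ ?_ ?_ ?_ ?_).2
  · filter_upwards [Iio_mem_nhds hx1] with y hy
    exact (cont_pow hy s).aestronglyMeasurable
  · exact (cont_pow hx1 s).intervalIntegrable _ _
  · refine Continuous.aestronglyMeasurable ?_
    exact (continuous_const.mul (cont_pow hx1 (s - 1))).mul (by fun_prop)
  · refine Eventually.of_forall fun t _ y hy => ?_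
    have hy' : y < (1 + x) / 2 := hy
    have h1 := base_ge hy'.le hc t
    have hp : 0 < (1 - y * Real.sin t ^ 2) ^ (s - 1) :=
      Real.rpow_pos_of_pos (base_pos (hy'.trans hc1) t) _
    have h2 : (1 - y * Real.sin t ^ 2) ^ (s - 1) ≤ (1 - (1 + x) / 2) ^ (s - 1) :=
      Real.rpow_le_rpow_of_nonpos (by linarith) h1 (by linarith)
    rw [norm_mul, norm_mul, Real.norm_eq_abs, Real.norm_eq_abs, Real.norm_eq_abs, abs_of_pos hp,
      abs_neg, abs_of_nonneg (sq_nonneg (Real.sin t))]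
    have h3 := Real.sin_sq_le_one t
    have h4 := sq_nonneg (Real.sin t)
    calc |s| * (1 - y * Real.sin t ^ 2) ^ (s - 1) * Real.sin t ^ 2
        ≤ |s| * (1 - y * Real.sin t ^ 2) ^ (s - 1) * 1 := by gcongr
      _ ≤ _ := by rw [mul_one]; gcongr
  · exact intervalIntegrable_const
  · refine Eventually.of_forall fun t _ y hy => ?_
    have hy' : y < (1 + x) / 2 := hy
    have hb := base_pos (hy'.trans hc1) t
    have h1 : HasDerivAt (fun y : ℝ => 1 - y * Real.sin t ^ 2) (-Real.sin t ^ 2) y := by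
      simpa using ((hasDerivAt_id y).mul_const (Real.sin t ^ 2)).const_sub 1
    refine (h1.rpow_const (p := s) (Or.inl hb.ne')).congr_deriv ?_
    ring

noncomputable def PP (x : ℝ) : ℝ := (E x - (1 - x) * K x) / 2

lemma pow_half {A : ℝ} (hA : 0 < A) : A ^ ((1/2 : ℝ)) = A * A ^ (-(1/2) : ℝ) := by
  rw [show (1/2 : ℝ) = 1 + -(1/2) by norm_num, Real.rpow_add hA, Real.rpow_one]; norm_num

lemma pow_nhalf {A : ℝ} (hA : 0 < A) : A ^ (-(1/2) : ℝ) = A * A ^ (-(1/2) - 1 : ℝ) := by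
  rw [show (-(1/2) : ℝ) = 1 + (-(1/2) - 1) by norm_num, Real.rpow_add hA, Real.rpow_one]; norm_num

lemma hasDeriv_E {x : ℝ} (hx0 : 0 < x) (hx1 : x < 1) :
    HasDerivAt E ((E x - K x) / (2 * x)) x := by
  refine HasDerivAt.congr_deriv (f := E)
    (hasDeriv_J (1/2) (by norm_num) (by linarith : -1 < x) hx1) (Eq.symm ?_)
  unfold E K
  rw [← intervalIntegral.integral_sub ((cont_pow hx1 _).intervalIntegrable _ _)
    ((cont_pow hx1 _).intervalIntegrable _ _), ← intervalIntegral.integral_div]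
  refine intervalIntegral.integral_congr fun t _ => ?_
  have hb := base_pos hx1 t
  rw [pow_half hb, show (1/2 - 1 : ℝ) = -(1/2) by norm_num]
  field_simp
  ring

lemma hasDeriv_K {x : ℝ} (hx0 : 0 < x) (hx1 : x < 1) :
    HasDerivAt K (PP x / (x * (1 - x))) x := by
  refine HasDerivAt.congr_deriv (f := K)
    (hasDeriv_J (-(1/2)) (by norm_num) (by linarith : -1 < x) hx1) (Eq.symm ?_)
  have hx1' : (1 - x) ≠ 0 := by linarith
  have hH : ∀ t : ℝ, HasDerivAt
      (fun t => Real.sin t * Real.cos t * (1 - x * Real.sin t ^ 2) ^ (-(1/2) : ℝ))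
      ((Real.cos t ^ 2 - Real.sin t ^ 2) * (1 - x * Real.sin t ^ 2) ^ (-(1/2) : ℝ)
        + x * Real.sin t ^ 2 * Real.cos t ^ 2 * (1 - x * Real.sin t ^ 2) ^ (-(1/2) - 1 : ℝ)) t := by
    intro t
    have hb := base_pos hx1 t
    have h1 : HasDerivAt (fun t : ℝ => 1 - x * Real.sin t ^ 2)
        (-(x * (2 * Real.sin t * Real.cos t))) t := by
      simpa using (((Real.hasDerivAt_sin t).pow 2).const_mul x).const_sub 1
    refine (((Real.hasDerivAt_sin t).mul (Real.hasDerivAt_cos t)).mul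
      (h1.rpow_const (p := -(1/2)) (Or.inl hb.ne'))).congr_deriv ?_
    simp only [Pi.mul_apply]
    ring
  have hc : Continuous fun t : ℝ =>
      ((Real.cos t ^ 2 - Real.sin t ^ 2) * (1 - x * Real.sin t ^ 2) ^ (-(1/2) : ℝ)
        + x * Real.sin t ^ 2 * Real.cos t ^ 2 * (1 - x * Real.sin t ^ 2) ^ (-(1/2) - 1 : ℝ)) := by
    have := cont_pow hx1 (-(1/2))
    have := cont_pow hx1 (-(1/2) - 1)
    fun_prop
  have hF := intervalIntegral.integral_eq_sub_of_hasDerivAt (a := 0) (b := π / 2)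
    (fun t _ => hH t) (hc.intervalIntegrable _ _)
  simp only [Real.cos_pi_div_two, Real.sin_zero, mul_zero, zero_mul, sub_zero] at hF
  have e : PP x / (x * (1 - x)) = PP x / (x * (1 - x)) - 1 / (2 * (1 - x)) * (∫ t in (0:ℝ)..(π/2),
      ((Real.cos t ^ 2 - Real.sin t ^ 2) * (1 - x * Real.sin t ^ 2) ^ (-(1/2) : ℝ)
        + x * Real.sin t ^ 2 * Real.cos t ^ 2 * (1 - x * Real.sin t ^ 2) ^ (-(1/2) - 1 : ℝ))) := by
    rw [hF]; ring
  rw [e]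
  unfold PP E K
  have i1 := (cont_pow hx1 (1/2)).intervalIntegrable (μ := MeasureTheory.volume) 0 (π/2)
  have i2 := (cont_pow hx1 (-(1/2))).intervalIntegrable (μ := MeasureTheory.volume) 0 (π/2)
  have i3 := hc.intervalIntegrable (μ := MeasureTheory.volume) 0 (π/2)
  rw [← intervalIntegral.integral_const_mul, ← intervalIntegral.integral_const_mul,
    ← intervalIntegral.integral_sub i1 (i2.const_mul _), ← intervalIntegral.integral_div,
    ← intervalIntegral.integral_div,
    ← intervalIntegral.integral_sub (((i1.sub (i2.const_mul _)).div_const _).div_const _)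
      (i3.const_mul _)]
  refine intervalIntegral.integral_congr fun t _ => ?_
  have hb := base_pos hx1 t
  rw [pow_half hb, pow_nhalf hb, Real.cos_sq']
  generalize (1 - x * Real.sin t ^ 2) ^ (-(1/2) - 1 : ℝ) = a
  field_simp
  ring

lemma hasDeriv_PP {x : ℝ} (hx0 : 0 < x) (hx1 : x < 1) : HasDerivAt PP (K x / 4) x := by
  have h := (((hasDeriv_E hx0 hx1).sub
    (((hasDerivAt_id x).const_sub 1).mul (hasDeriv_K hx0 hx1))).div_const 2)
  refine HasDerivAt.congr_deriv (f := PP) h ?_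
  have hx1' : (1 - x) ≠ 0 := by linarith
  simp only [PP, id]
  field_simp
  ring

lemma contAt_K {x : ℝ} (hx0 : -1 < x) (hx1 : x < 1) : ContinuousAt K x :=
  (hasDeriv_J (-(1/2)) (by norm_num) hx0 hx1).continuousAt

lemma contAt_PP {x : ℝ} (hx0 : -1 < x) (hx1 : x < 1) : ContinuousAt PP x := by
  have h1 := contAt_K hx0 hx1
  have h2 : ContinuousAt E x := (hasDeriv_J (1/2) (by norm_num) hx0 hx1).continuousAt
  unfold PP
  fun_prop

lemma K_pos {x : ℝ} (hx1 : x < 1) : 0 < K x := by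
  unfold K
  refine intervalIntegral.intervalIntegral_pos_of_pos ((cont_pow hx1 _).intervalIntegrable _ _)
    (fun t => Real.rpow_pos_of_pos (base_pos hx1 t) _) (by positivity)

lemma PP_zero : PP 0 = 0 := by simp [PP, E, K]

lemma E_le {x : ℝ} (hx0 : 0 ≤ x) (hx1 : x < 1) : E x ≤ π / 2 := by
  have : E x ≤ ∫ t in (0 : ℝ)..(π / 2), (1 : ℝ) := by
    refine intervalIntegral.integral_mono_on (by positivity) ((cont_pow hx1 _).intervalIntegrable _ _)
      intervalIntegrable_const fun t _ => ?_
    refine Real.rpow_le_one (base_pos hx1 t).le ?_ (by norm_num)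
    nlinarith [sq_nonneg (Real.sin t)]
  simpa using this

lemma PP_le {x : ℝ} (hx0 : 0 ≤ x) (hx1 : x < 1) : PP x ≤ π / 4 := by
  have := E_le hx0 hx1
  have := mul_pos (sub_pos.2 hx1) (K_pos hx1)
  unfold PP; linarith

/-- A barrier principle. -/
lemma barrier {φ φ' : ℝ → ℝ} {b : ℝ} (h0 : φ 0 = 0)
    (hc : ∀ x, 0 ≤ x → x < b → ContinuousAt φ x)
    (hd : ∀ x, 0 < x → x < b → HasDerivAt φ (φ' x) x)
    (hp : ∀ x, 0 < x → x < b → φ x < 0 → 0 < φ' x) {x : ℝ} (hx0 : 0 ≤ x) (hxb : x < b) :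
    0 ≤ φ x := by
  by_contra! hneg
  obtain ⟨y, hy, hmin⟩ := isCompact_Icc.exists_isMinOn (s := Icc 0 x) ⟨0, by simp [hx0]⟩
    (fun z hz => (hc z hz.1 (hz.2.trans_lt hxb)).continuousWithinAt)
  have hyneg : φ y < 0 := (hmin (show x ∈ Icc 0 x from ⟨hx0, le_rfl⟩)).trans_lt hneg
  have hy0 : 0 < y := by
    rcases hy.1.eq_or_lt with h | h
    · rw [← h, h0] at hyneg; exact absurd hyneg (lt_irrefl _)
    · exact h
  have hyb := hy.2.trans_lt hxb
  have hpos := hp y hy0 hyb hyneg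
  have hs := (hasDerivAt_iff_tendsto_slope.1 (hd y hy0 hyb)).eventually (lt_mem_nhds hpos)
  have hs2 : ∀ᶠ z in nhdsWithin y (Iio y), 0 < slope φ y z :=
    hs.filter_mono (nhdsWithin_mono _ fun z hz => (ne_of_lt hz))
  have hs3 : ∀ᶠ z in nhdsWithin y (Iio y), z ∈ Ioo 0 y := Ioo_mem_nhdsLT hy0
  obtain ⟨z, hz1, hz2⟩ := (hs2.and hs3).exists
  have hz3 : φ y ≤ φ z := hmin ⟨hz2.1.le, hz2.2.le.trans hy.2⟩
  rw [slope_def_field] at hz1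
  have : (φ z - φ y) / (z - y) ≤ 0 :=
    div_nonpos_of_nonneg_of_nonpos (by linarith) (by linarith [hz2.2])
  linarith

lemma PP_pos {x : ℝ} (hx0 : 0 < x) (hx1 : x < 1) : 0 < PP x := by
  have h : StrictMonoOn PP (Ico 0 1) := by
    refine strictMonoOn_of_deriv_pos (convex_Ico 0 1)
      (fun y hy => (contAt_PP (by linarith [hy.1]) hy.2).continuousWithinAt) fun y hy => ?_
    rw [interior_Ico] at hy
    rw [(hasDeriv_PP hy.1 hy.2).deriv]
    linarith [K_pos hy.2]
  have := h ⟨le_rfl, one_pos⟩ ⟨hx0.le, hx1⟩ hx0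
  rwa [PP_zero] at this

lemma PP_upper {x : ℝ} (hx0 : 0 < x) (hx1 : x < 1) :
    PP x ≤ x * (1 - x / 8) / 4 * K x := by
  have key : 0 ≤ x * (1 - x / 8) / 4 * K x - PP x := by
    refine barrier (φ := fun x => x * (1 - x / 8) / 4 * K x - PP x)
      (φ' := fun x => (1 - x / 4) / 4 * K x + x * (1 - x / 8) / 4 * (PP x / (x * (1 - x))) - K x / 4)
      (b := 1) (by simp [PP_zero]) ?_ ?_ ?_ hx0.le hx1
    · intro y h0 h1
      have := contAt_K (by linarith : -1 < y) h1
      have := contAt_PP (by linarith : -1 < y) h1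
      fun_prop
    · intro y h0 h1
      have hq : HasDerivAt (fun x : ℝ => x * (1 - x / 8) / 4) ((1 - y / 4) / 4) y := by
        refine (((hasDerivAt_id y).mul (((hasDerivAt_id y).div_const 8).const_sub 1)).div_const
          4).congr_deriv ?_
        simp only [id]; ring
      exact (hq.mul (hasDeriv_K h0 h1)).sub (hasDeriv_PP h0 h1)
    · intro y h0 h1 hneg
      have hK := K_pos h1
      have h1' : 0 < 1 - y := by linarith
      have e : (1 - y / 4) / 4 * K y + y * (1 - y / 8) / 4 * (PP y / (y * (1 - y))) - K y / 4
          = ((1 - y / 8) * PP y - y * (1 - y) / 4 * K y) / (4 * (1 - y)) := by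
        field_simp; ring
      simp only [e]
      refine div_pos ?_ (by positivity)
      have h3 : 0 < (1 - y / 8) * (PP y - y * (1 - y / 8) / 4 * K y) :=
        mul_pos (by linarith) (by linarith)
      have h4 : 0 < y * K y * (3 / 4 * y + y ^ 2 / 64) := by positivity
      nlinarith
  linarith

lemma PP_lower {x : ℝ} (hx0 : 0 < x) (hx1 : x < 11 / 20) :
    x * (1 - x / 8 - x ^ 2 / 8) / 4 * K x ≤ PP x := by
  have key : 0 ≤ PP x - x * (1 - x / 8 - x ^ 2 / 8) / 4 * K x := by
    refine barrier (φ := fun x => PP x - x * (1 - x / 8 - x ^ 2 / 8) / 4 * K x)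
      (φ' := fun x => K x / 4 - ((1 - x / 4 - 3 * x ^ 2 / 8) / 4 * K x
        + x * (1 - x / 8 - x ^ 2 / 8) / 4 * (PP x / (x * (1 - x)))))
      (b := 11 / 20) (by simp [PP_zero]) ?_ ?_ ?_ hx0.le hx1
    · intro y h0 h1
      have := contAt_K (by linarith : -1 < y) (by linarith)
      have := contAt_PP (by linarith : -1 < y) (by linarith)
      fun_prop
    · intro y h0 h1
      have hq : HasDerivAt (fun x : ℝ => x * (1 - x / 8 - x ^ 2 / 8) / 4)
          ((1 - y / 4 - 3 * y ^ 2 / 8) / 4) y := by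
        refine (((hasDerivAt_id y).mul ((((hasDerivAt_id y).div_const 8).const_sub 1).sub
          (((hasDerivAt_id y).pow 2).div_const 8))).div_const 4).congr_deriv ?_
        simp [id]; ring
      exact (hasDeriv_PP h0 (by linarith)).sub (hq.mul (hasDeriv_K h0 (by linarith)))
    · intro y h0 h1 hneg
      have hK := K_pos (show y < 1 by linarith)
      have h1' : 0 < 1 - y := by linarith
      have e : K y / 4 - ((1 - y / 4 - 3 * y ^ 2 / 8) / 4 * K y
            + y * (1 - y / 8 - y ^ 2 / 8) / 4 * (PP y / (y * (1 - y))))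
          = ((y / 4 + 3 * y ^ 2 / 8) * (1 - y) * K y - (1 - y / 8 - y ^ 2 / 8) * PP y)
            / (4 * (1 - y)) := by
        field_simp; ring
      simp only [e]
      refine div_pos ?_ (by positivity)
      have h3 : 0 < (1 - y / 8 - y ^ 2 / 8) * (y * (1 - y / 8 - y ^ 2 / 8) / 4 * K y - PP y) :=
        mul_pos (by nlinarith) (by linarith)
      have h5 : 0 < (1 + 3 * y / 2) * (1 - y) - (1 - y / 8 - y ^ 2 / 8) ^ 2 := by
        have : (1 + 3 * y / 2) * (1 - y) - (1 - y / 8 - y ^ 2 / 8) ^ 2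
          = y * (3 / 4 - 81 / 64 * y - y ^ 2 / 32 - y ^ 3 / 64) := by ring
        rw [this]
        refine mul_pos h0 ?_
        have : y ^ 2 ≤ 11 / 20 * y := by nlinarith
        have : y ^ 3 ≤ (11 / 20) ^ 2 * y := by nlinarith
        linarith
      have h4 := mul_pos (mul_pos h0 hK) h5
      nlinarith
  linarith

noncomputable def ww (x : ℝ) : ℝ := PP x / (x * K x)

noncomputable def RR (x : ℝ) : ℝ := (1 - x) / 4 - ww x * (1 - 2 * x) - x * ww x ^ 2

lemma ww_pos {x : ℝ} (hx0 : 0 < x) (hx1 : x < 1) : 0 < ww x :=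
  div_pos (PP_pos hx0 hx1) (mul_pos hx0 (K_pos hx1))

lemma ww_upper {x : ℝ} (hx0 : 0 < x) (hx1 : x < 1) : ww x ≤ (1 - x / 8) / 4 := by
  unfold ww
  rw [div_le_iff₀ (mul_pos hx0 (K_pos hx1))]
  linarith [PP_upper hx0 hx1]

lemma ww_lower {x : ℝ} (hx0 : 0 < x) (hx1 : x < 11 / 20) :
    (1 - x / 8 - x ^ 2 / 8) / 4 ≤ ww x := by
  unfold ww
  rw [le_div_iff₀ (mul_pos hx0 (K_pos (by linarith)))]
  linarith [PP_lower hx0 hx1]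

lemma RR_pos {x : ℝ} (hx0 : 0 < x) (hx1 : x < 1) : 0 < RR x := by
  have h1 := ww_pos hx0 hx1
  have h2 := ww_upper hx0 hx1
  unfold RR
  generalize ww x = w at *
  have e : (1 - x) / 4 - w * (1 - 2 * x) - x * w ^ 2
      = 4 * w * (3 * x / 16) + (1 - 4 * w) * ((1 - x) / 4) + x * w * (1 / 4 - w) := by ring
  rw [e]
  have a1 : 0 < 4 * w * (3 * x / 16) := by positivity
  have a2 : 0 ≤ (1 - 4 * w) * ((1 - x) / 4) := mul_nonneg (by linarith) (by linarith)
  have a3 : 0 ≤ x * w * (1 / 4 - w) := mul_nonneg (by positivity) (by linarith)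
  linarith

lemma RR_lt {x : ℝ} (hx0 : 0 < x) (hx1 : x < 1) : RR x < 7 / 32 * x := by
  have h1 := ww_pos hx0 hx1
  have h2 := ww_upper hx0 hx1
  have h3 := fun h => ww_lower hx0 (x := x) h
  unfold RR
  generalize ww x = w at *
  suffices 0 < x * w ^ 2 + (1 - 2 * x) * w - 1 / 4 + 15 * x / 32 by linarith
  rcases lt_or_ge x (11 / 20) with hx | hx
  · have h3 := h3 hx
    set r := (1 - x / 8 - x ^ 2 / 8) / 4 with hr
    have hr1 : 1 / 5 ≤ r := by rw [hr]; nlinarith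
    have e : x * w ^ 2 + (1 - 2 * x) * w - 1 / 4 + 15 * x / 32
      = (w - r) * (x * (w + r) + 1 - 2 * x) + (x * r ^ 2 + (1 - 2 * x) * r - 1 / 4 + 15 * x / 32) := by
      ring
    rw [e]
    have a1 : 0 ≤ (w - r) * (x * (w + r) + 1 - 2 * x) := mul_nonneg (by linarith) (by nlinarith)
    have a2 : x * r ^ 2 + (1 - 2 * x) * r - 1 / 4 + 15 * x / 32
      = x ^ 2 * (1 / 64 + 49 * x / 1024 + x ^ 2 / 512 + x ^ 3 / 1024) := by
      rw [hr]; ring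
    rw [a2]
    have : 0 < x ^ 2 * (1 / 64 + 49 * x / 1024 + x ^ 2 / 512 + x ^ 3 / 1024) := by positivity
    linarith
  · rcases lt_or_ge x (2 / 3) with hx' | hx'
    · have e : 4 * x * (x * w ^ 2 + (1 - 2 * x) * w - 1 / 4 + 15 * x / 32)
        = (2 * x * w + 1 - 2 * x) ^ 2 - (1 - 3 * x + 17 / 8 * x ^ 2) := by ring
      have a : 1 - 3 * x + 17 / 8 * x ^ 2 < 0 := by nlinarith
      have : 0 < 4 * x * (x * w ^ 2 + (1 - 2 * x) * w - 1 / 4 + 15 * x / 32) := by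
        rw [e]; linarith [sq_nonneg (2 * x * w + 1 - 2 * x)]
      exact pos_of_mul_pos_right this (by positivity)
    · have e : x * w ^ 2 + (1 - 2 * x) * w - 1 / 4 + 15 * x / 32
        = (1 / 4 - w) * (2 * x - 1 - x * (w + 1 / 4)) + x / 32 := by ring
      rw [e]
      have : 0 ≤ (1 / 4 - w) * (2 * x - 1 - x * (w + 1 / 4)) :=
        mul_nonneg (by linarith) (by nlinarith)
      linarith

lemma RR_ge {x : ℝ} (hx0 : 0 < x) (hx1 : x < 1 / 2) : (7 / 32 - x) * x ≤ RR x := by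
  have h1 := ww_pos hx0 (by linarith)
  have h2 := ww_upper hx0 (by linarith)
  unfold RR
  generalize ww x = w at *
  set r := (1 - x / 8) / 4 with hr
  have e : (1 - x) / 4 - w * (1 - 2 * x) - x * w ^ 2 = (r - w) * (1 - 2 * x + x * (w + r))
     + x * (7 / 32 - 3 * x / 64 - x ^ 2 / 1024) := by rw [hr]; ring
  rw [e]
  have a : 0 ≤ (r - w) * (1 - 2 * x + x * (w + r)) := by
    refine mul_nonneg (by linarith) ?_
    have : 0 ≤ x * (w + r) := mul_nonneg hx0.le (by linarith)
    linarith
  have b : 0 ≤ x * (x - 3 * x / 64 - x ^ 2 / 1024) := mul_nonneg hx0.le (by nlinarith)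
  linarith

lemma hasDeriv_f (p : ℝ) {x : ℝ} (hx0 : 0 < x) (hx1 : x < 1) :
    HasDerivAt (fun x : ℝ => Real.log ((1 - x) ^ p * K x))
      (PP x / (x * (1 - x) * K x) - p / (1 - x)) x := by
  have hK := K_pos hx1
  have h1 : 0 < 1 - x := by linarith
  have hl : HasDerivAt (fun x : ℝ => p * Real.log (1 - x) + Real.log (K x))
      (PP x / (x * (1 - x) * K x) - p / (1 - x)) x := by
    refine (((((hasDerivAt_id x).const_sub 1).log h1.ne').const_mul p).add
      ((hasDeriv_K hx0 hx1).log hK.ne')).congr_deriv ?_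
    simp only [id]
    field_simp
    ring
  refine hl.congr_of_eventuallyEq ?_
  filter_upwards [Iio_mem_nhds hx1] with y hy
  have hy' : y < 1 := hy
  have h2 : 0 < 1 - y := by linarith
  rw [Real.log_mul (Real.rpow_pos_of_pos h2 p).ne' (K_pos hy').ne', Real.log_rpow h2]

lemma hasDeriv_f' (p : ℝ) {x : ℝ} (hx0 : 0 < x) (hx1 : x < 1) :
    HasDerivAt (fun x : ℝ => PP x / (x * (1 - x) * K x) - p / (1 - x))
      ((RR x / x - p) / (1 - x) ^ 2) x := by
  have hK := K_pos hx1
  have h1 : 0 < 1 - x := by linarith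
  have hq : HasDerivAt (fun x : ℝ => x * (1 - x)) (1 - 2 * x) x := by
    refine ((hasDerivAt_id x).mul ((hasDerivAt_id x).const_sub 1)).congr_deriv ?_
    simp only [id]; ring
  have hn : HasDerivAt (fun x : ℝ => p / (1 - x)) (p / (1 - x) ^ 2) x := by
    refine ((hasDerivAt_const x p).div ((hasDerivAt_id x).const_sub 1) h1.ne').congr_deriv ?_
    simp only [id]; ring
  refine (((hasDeriv_PP hx0 hx1).div (hq.mul (hasDeriv_K hx0 hx1)) (by simp only [Pi.mul_apply]; positivity)).sub
    hn).congr_deriv ?_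
  simp only [RR, ww, Pi.mul_apply]
  field_simp
  ring

lemma f_convex {p a b : ℝ} (ha : 0 ≤ a) (hb : b ≤ 1) (h : ∀ x ∈ Ioo a b, p < RR x / x) :
    StrictConvexOn ℝ (Ioo a b) (fun x : ℝ => Real.log ((1 - x) ^ p * K x)) := by
  have m : ∀ x ∈ Ioo a b, 0 < x ∧ x < 1 := fun x hx =>
    ⟨ha.trans_lt hx.1, hx.2.trans_le hb⟩
  refine StrictMonoOn.strictConvexOn_of_deriv (convex_Ioo a b)
    (fun x hx => (hasDeriv_f p (m x hx).1 (m x hx).2).continuousAt.continuousWithinAt) ?_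
  rw [interior_Ioo]
  have h2 : StrictMonoOn (fun x : ℝ => PP x / (x * (1 - x) * K x) - p / (1 - x)) (Ioo a b) := by
    refine strictMonoOn_of_deriv_pos (convex_Ioo a b)
      (fun x hx => (hasDeriv_f' p (m x hx).1 (m x hx).2).continuousAt.continuousWithinAt) ?_
    intro x hx
    rw [interior_Ioo] at hx
    rw [(hasDeriv_f' p (m x hx).1 (m x hx).2).deriv]
    have := h x hx
    have := (m x hx).2
    exact div_pos (by linarith) (pow_pos (by linarith) 2)
  exact h2.congr fun x hx => (hasDeriv_f p (m x hx).1 (m x hx).2).deriv.symm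

lemma f_concave {p a b : ℝ} (ha : 0 ≤ a) (hb : b ≤ 1) (h : ∀ x ∈ Ioo a b, RR x / x < p) :
    StrictConcaveOn ℝ (Ioo a b) (fun x : ℝ => Real.log ((1 - x) ^ p * K x)) := by
  have m : ∀ x ∈ Ioo a b, 0 < x ∧ x < 1 := fun x hx =>
    ⟨ha.trans_lt hx.1, hx.2.trans_le hb⟩
  refine StrictAntiOn.strictConcaveOn_of_deriv (convex_Ioo a b)
    (fun x hx => (hasDeriv_f p (m x hx).1 (m x hx).2).continuousAt.continuousWithinAt) ?_
  rw [interior_Ioo]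
  have h2 : StrictAntiOn (fun x : ℝ => PP x / (x * (1 - x) * K x) - p / (1 - x)) (Ioo a b) := by
    refine strictAntiOn_of_deriv_neg (convex_Ioo a b)
      (fun x hx => (hasDeriv_f' p (m x hx).1 (m x hx).2).continuousAt.continuousWithinAt) ?_
    intro x hx
    rw [interior_Ioo] at hx
    rw [(hasDeriv_f' p (m x hx).1 (m x hx).2).deriv]
    have := h x hx
    have := (m x hx).2
    exact div_neg_of_neg_of_pos (by linarith) (pow_pos (by linarith) 2)
  exact h2.congr fun x hx => (hasDeriv_f p (m x hx).1 (m x hx).2).deriv.symm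

lemma not_both {f : ℝ → ℝ} {a b : ℝ} (hab : a < b) (h1 : StrictConvexOn ℝ (Ioo a b) f)
    (h2 : StrictConcaveOn ℝ (Ioo a b) f) : False := by
  have hx : (2 * a + b) / 3 ∈ Ioo a b := ⟨by linarith, by linarith⟩
  have hy : (a + 2 * b) / 3 ∈ Ioo a b := ⟨by linarith, by linarith⟩
  have hne : (2 * a + b) / 3 ≠ (a + 2 * b) / 3 := by intro h; linarith
  have e1 := h1.2 hx hy hne (show (0:ℝ) < 1/2 by norm_num) (show (0:ℝ) < 1/2 by norm_num)
    (by norm_num)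
  have e2 := h2.2 hx hy hne (show (0:ℝ) < 1/2 by norm_num) (show (0:ℝ) < 1/2 by norm_num)
    (by norm_num)
  exact lt_asymm e1 e2

lemma K_lower {x : ℝ} (hx0 : 1 / 2 ≤ x) (hx1 : x < 1) :
    K (1 / 2) + PP (1 / 2) * Real.log (1 - 1 / 2) + PP (1 / 2) * (-Real.log (1 - x)) ≤ K x := by
  have hd : ∀ y ∈ Ico (1 / 2 : ℝ) 1, HasDerivAt (fun y => K y + PP (1 / 2) * Real.log (1 - y))
      (PP y / (y * (1 - y)) + PP (1 / 2) * (-1 / (1 - y))) y := by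
    intro y hy
    have h0 : 0 < y := by linarith [hy.1]
    have h1 : 0 < 1 - y := by linarith [hy.2]
    exact (hasDeriv_K h0 hy.2).add ((((hasDerivAt_id y).const_sub 1).log h1.ne').const_mul _)
  have hmP : MonotoneOn PP (Ico 0 1) := by
    refine monotoneOn_of_deriv_nonneg (convex_Ico 0 1)
      (fun y hy => (contAt_PP (by linarith [hy.1]) hy.2).continuousWithinAt) ?_ fun y hy => ?_
    · intro y hy
      rw [interior_Ico] at hy
      exact (hasDeriv_PP hy.1 hy.2).differentiableAt.differentiableWithinAt
    rw [interior_Ico] at hy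
    rw [(hasDeriv_PP hy.1 hy.2).deriv]
    linarith [K_pos hy.2]
  have hm : MonotoneOn (fun y => K y + PP (1 / 2) * Real.log (1 - y)) (Ico (1 / 2) 1) := by
    refine monotoneOn_of_deriv_nonneg (convex_Ico _ _)
      (fun y hy => (hd y hy).continuousAt.continuousWithinAt)
      (fun y hy => (hd y (interior_subset hy)).differentiableAt.differentiableWithinAt) ?_
    intro y hy
    have hy := interior_subset hy
    rw [(hd y hy).deriv]
    have h0 : 0 < y := by linarith [hy.1]
    have h1 : 0 < 1 - y := by linarith [hy.2]
    have hP := hmP (show (1 / 2 : ℝ) ∈ Ico 0 1 by constructor <;> norm_num) ⟨h0.le, hy.2⟩ hy.1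
    have hPP := PP_pos h0 hy.2
    have e : PP y / (y * (1 - y)) + PP (1 / 2) * (-1 / (1 - y))
      = (PP y - y * PP (1 / 2)) / (y * (1 - y)) := by field_simp; ring
    rw [e]
    refine div_nonneg ?_ (by positivity)
    nlinarith [PP_pos (show (0:ℝ) < 1 / 2 by norm_num) (by norm_num), hy.2]
  have := hm (show (1 / 2 : ℝ) ∈ Ico (1 / 2) 1 by constructor <;> norm_num) ⟨hx0, hx1⟩ hx0
  simp only at this
  linarith

lemma K_tendsto : Tendsto K (nhdsWithin 1 (Iio 1)) atTop := by
  have hP : 0 < PP (1 / 2) := PP_pos (by norm_num) (by norm_num)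
  have h1 : Tendsto (fun x : ℝ => 1 - x) (nhdsWithin 1 (Iio 1)) (nhdsWithin 0 (Ioi 0)) := by
    refine tendsto_nhdsWithin_iff.2 ⟨?_, ?_⟩
    · have : ContinuousAt (fun x : ℝ => 1 - x) 1 := by fun_prop
      have h := this.tendsto
      simp only [sub_self] at h
      exact h.mono_left nhdsWithin_le_nhds
    · filter_upwards [self_mem_nhdsWithin] with x hx
      exact sub_pos.2 (mem_Iio.1 hx)
  have h2 : Tendsto (fun x : ℝ => -Real.log (1 - x)) (nhdsWithin 1 (Iio 1)) atTop :=
    tendsto_neg_atBot_atTop.comp (Real.tendsto_log_nhdsGT_zero.comp h1)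
  refine tendsto_atTop_mono' _ ?_ (tendsto_atTop_add_const_left _
    (K (1 / 2) + PP (1 / 2) * Real.log (1 - 1 / 2)) (h2.const_mul_atTop hP))
  filter_upwards [Ioo_mem_nhdsLT (show (1 / 2 : ℝ) < 1 by norm_num)] with x hx
  exact K_lower hx.1.le hx.2

lemma ww_tendsto : Tendsto ww (nhdsWithin 1 (Iio 1)) (nhds 0) := by
  have h : Tendsto (fun x => (π / 2) / K x) (nhdsWithin 1 (Iio 1)) (nhds 0) :=
    K_tendsto.const_div_atTop _
  refine squeeze_zero' ?_ ?_ h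
  · filter_upwards [Ioo_mem_nhdsLT (show (1 / 2 : ℝ) < 1 by norm_num)] with x hx
    exact (ww_pos (by linarith [hx.1]) hx.2).le
  · filter_upwards [Ioo_mem_nhdsLT (show (1 / 2 : ℝ) < 1 by norm_num)] with x hx
    have hx0 : 0 < x := by linarith [hx.1]
    have hK := K_pos hx.2
    unfold ww
    rw [div_le_div_iff₀ (by positivity) hK]
    have h1 := PP_le hx0.le hx.2
    have h2 : PP x ≤ π / 2 * x := by nlinarith [hx.1, Real.pi_pos]
    nlinarith

lemma RR_tendsto : Tendsto (fun x => RR x / x) (nhdsWithin 1 (Iio 1)) (nhds 0) := by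
  have hx : Tendsto (fun x : ℝ => x) (nhdsWithin 1 (Iio 1)) (nhds 1) :=
    tendsto_id.mono_left nhdsWithin_le_nhds
  have h := ((((hx.const_sub 1).div_const 4).sub (ww_tendsto.mul ((hx.const_mul 2).const_sub 1))).sub
    (hx.mul (ww_tendsto.pow 2))).div hx one_ne_zero
  have e : ((1 - 1) / 4 - 0 * (1 - 2 * 1) - 1 * 0 ^ 2) / 1 = (0 : ℝ) := by norm_num
  rw [e] at h
  exact h

theorem stmt12 (p : ℝ) :
    (StrictConcaveOn ℝ (Ioo 0 1)
      (fun x : ℝ => Real.log ((1 - x) ^ p * K x)) ↔ p ≥ 7/32) ∧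
    (StrictConvexOn ℝ (Ioo 0 1)
      (fun x : ℝ => Real.log ((1 - x) ^ p * K x)) ↔ p ≤ 0) := by
  refine ⟨⟨fun h => ?_, fun h => ?_⟩, ⟨fun h => ?_, fun h => ?_⟩⟩
  · by_contra! hp
    set b := min (1 / 2) (7 / 32 - p) with hb
    have hb0 : 0 < b := lt_min (by norm_num) (by linarith)
    have hb1 : b ≤ 1 / 2 := min_le_left _ _
    have hb2 : b ≤ 7 / 32 - p := min_le_right _ _
    refine not_both hb0 (f_convex le_rfl (by linarith) fun x hx => ?_)
      (h.subset (Ioo_subset_Ioo_right (by linarith)) (convex_Ioo _ _))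
    rw [lt_div_iff₀ hx.1]
    have h1 := RR_ge hx.1 (hx.2.trans_le hb1)
    have h2 : p * x < (7 / 32 - x) * x := mul_lt_mul_of_pos_right (by linarith [hx.2]) hx.1
    linarith
  · refine f_concave le_rfl le_rfl fun x hx => ?_
    have := (div_lt_iff₀ hx.1).2 (RR_lt hx.1 hx.2)
    linarith
  · by_contra! hp
    have hev := RR_tendsto.eventually (gt_mem_nhds hp)
    obtain ⟨a, ha, hsub⟩ := (mem_nhdsLT_iff_exists_Ioo_subset).1 hev
    have ha1 : a < 1 := ha
    refine not_both (max_lt ha1 one_pos)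
      (h.subset (Ioo_subset_Ioo_left (le_max_right a 0)) (convex_Ioo _ _))
      (f_concave (le_max_right a 0) le_rfl fun x hx => ?_)
    exact hsub ⟨(le_max_left a 0).trans_lt hx.1, hx.2⟩
  · refine f_convex le_rfl le_rfl fun x hx => ?_
    have := div_pos (RR_pos hx.1 hx.2) hx.1
    linarith
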